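/- Let k be a field and 𝒜 a k-subalgebra of M₂(k). Then the following are equivalent: (1) Δ(A,B) = 0 for all A, B ∈ 𝒜; (2) 𝒜 ≠ M₂(k); (3) 𝒜 is commutative or there exists a one-dimensional k-subspace W of k² invariant under 𝒜 (that is, A·w ∈ W for every A ∈ 𝒜 and w ∈ W). -/

import Mathlib

/-- The discriminant `Δ(A,B)` of a pair of `2 × 2` matrices. -/
def matrixDisc {R : Type*} [CommRing R] (A B : Matrix (Fin 2) (Fin 2) R) : R :=
  A.trace ^ 2 * B.det + B.trace ^ 2 * A.det + (A * B).trace ^ 2 -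
    A.trace * B.trace * (A * B).trace - 4 * A.det * B.det

/-- The discriminant is the negative of the determinant of the coordinates of `1, A, B, AB`. -/
theorem det_coords_eq_neg_matrixDisc {R : Type*} [CommRing R] (A B : Matrix (Fin 2) (Fin 2) R) :
    Matrix.det !![1, 0, 0, 1; A 0 0, A 0 1, A 1 0, A 1 1; B 0 0, B 0 1, B 1 0, B 1 1;
      (A * B) 0 0, (A * B) 0 1, (A * B) 1 0, (A * B) 1 1] = -matrixDisc A B := by
  simp [matrixDisc, Matrix.det_succ_row_zero, Fin.sum_univ_succ, Matrix.trace_fin_two,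
    Matrix.mul_apply, Fin.succAbove]
  ring

/-- The discriminant is the negative of the determinant of the commutator. -/
theorem matrixDisc_eq_neg_det_commutator {R : Type*} [CommRing R]
    (A B : Matrix (Fin 2) (Fin 2) R) : matrixDisc A B = -(A * B - B * A).det := by
  simp only [matrixDisc, Matrix.det_fin_two, Matrix.trace_fin_two, Matrix.mul_apply,
    Fin.sum_univ_two, Matrix.sub_apply]
  ring

/-- Two matrices with nonzero discriminant generate the full matrix algebra. -/
theorem eq_top_of_matrixDisc_ne_zero {k : Type*} [Field k]
    {𝒜 : Subalgebra k (Matrix (Fin 2) (Fin 2) k)} {A B : Matrix (Fin 2) (Fin 2) k}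
    (hA : A ∈ 𝒜) (hB : B ∈ 𝒜) (h : matrixDisc A B ≠ 0) : 𝒜 = ⊤ := by
  rw [← neg_ne_zero, ← det_coords_eq_neg_matrixDisc] at h
  refine eq_top_iff.2 fun M _ => ?_
  obtain ⟨c, hc⟩ := (Matrix.vecMul_surjective_iff_isUnit.2
    ((Matrix.isUnit_iff_isUnit_det _).2 h.isUnit)) ![M 0 0, M 0 1, M 1 0, M 1 1]
  have key : M = c 0 • 1 + c 1 • A + c 2 • B + c 3 • (A * B) := by
    have h0 := congrFun hc 0
    have h1 := congrFun hc 1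
    have h2 := congrFun hc 2
    have h3 := congrFun hc 3
    simp [Matrix.vecMul, dotProduct, Fin.sum_univ_succ] at h0 h1 h2 h3
    ext i j
    fin_cases i <;> fin_cases j <;> simp [← h0, ← h1, ← h2, ← h3] <;> ring
  rw [key]
  exact add_mem (add_mem (add_mem (𝒜.smul_mem 𝒜.one_mem _) (𝒜.smul_mem hA _))
    (𝒜.smul_mem hB _)) (𝒜.smul_mem (𝒜.mul_mem hA hB) _)

theorem mul_mul_self_of_det_eq_zero {R : Type*} [CommRing R] {C : Matrix (Fin 2) (Fin 2) R}
    (hC : C.det = 0) (A : Matrix (Fin 2) (Fin 2) R) : C * A * C = (A * C).trace • C := by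
  rw [Matrix.det_fin_two] at hC
  ext i j
  fin_cases i <;> fin_cases j <;>
    simp [Matrix.mul_apply, Fin.sum_univ_two, Matrix.trace_fin_two] <;> grind

/-- A noncommutative subalgebra on which the discriminant vanishes has an invariant line, namely
the kernel of any nonzero commutator. -/
theorem exists_invariant_line_of_matrixDisc_eq_zero {k : Type*} [Field k]
    {𝒜 : Subalgebra k (Matrix (Fin 2) (Fin 2) k)}
    (h : ∀ A ∈ 𝒜, ∀ B ∈ 𝒜, matrixDisc A B = 0) {X Y : Matrix (Fin 2) (Fin 2) k}
    (hX : X ∈ 𝒜) (hY : Y ∈ 𝒜) (hXY : X * Y ≠ Y * X) :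
    ∃ W : Submodule k (Fin 2 → k), Module.finrank k W = 1 ∧
      ∀ A ∈ 𝒜, ∀ w ∈ W, A.mulVec w ∈ W := by
  obtain ⟨C, hC⟩ : ∃ C, C = X * Y - Y * X := ⟨_, rfl⟩
  have hC𝒜 : C ∈ 𝒜 := hC ▸ sub_mem (𝒜.mul_mem hX hY) (𝒜.mul_mem hY hX)
  have hC0 : C ≠ 0 := hC ▸ sub_ne_zero.2 hXY
  have hdet : C.det = 0 := by
    rw [hC, ← neg_eq_zero, ← matrixDisc_eq_neg_det_commutator, h X hX Y hY]
  have htr : C.trace = 0 := by rw [hC, Matrix.trace_sub, Matrix.trace_mul_comm, sub_self]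
  have hCAC : ∀ A ∈ 𝒜, C * A * C = 0 := fun A hA => by
    have htrAC : (A * C).trace = 0 := by
      have := h A hA C hC𝒜
      rw [matrixDisc, hdet, htr] at this
      exact (pow_eq_zero_iff two_ne_zero).1 (by linear_combination this)
    rw [mul_mul_self_of_det_eq_zero hdet, htrAC, zero_smul]
  have hle : C.mulVecLin.range ≤ C.mulVecLin.ker := by
    rintro _ ⟨v, rfl⟩
    have := hCAC 1 𝒜.one_mem
    rw [mul_one] at this
    rw [LinearMap.mem_ker, Matrix.mulVecLin_apply, Matrix.mulVecLin_apply, Matrix.mulVec_mulVec,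
      this, Matrix.zero_mulVec]
  have hrn := C.mulVecLin.finrank_range_add_finrank_ker
  rw [Module.finrank_fin_fun] at hrn
  have hpos : Module.finrank k C.mulVecLin.range ≠ 0 := fun h0 => hC0 <| by
    rw [Submodule.finrank_eq_zero, LinearMap.range_eq_bot] at h0
    exact Matrix.toLin'.injective (by simpa [Matrix.toLin'_apply'] using h0)
  have hmono := Submodule.finrank_mono hle
  have hrange : C.mulVecLin.range = C.mulVecLin.ker :=
    Submodule.eq_of_le_of_finrank_eq hle (by omega)
  refine ⟨C.mulVecLin.ker, by omega, fun A hA w hw => ?_⟩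
  obtain ⟨v, rfl⟩ := hrange ▸ hw
  rw [LinearMap.mem_ker, Matrix.mulVecLin_apply, Matrix.mulVecLin_apply, Matrix.mulVec_mulVec,
    Matrix.mulVec_mulVec, hCAC A hA, Matrix.zero_mulVec]

/-- A subspace invariant under all matrices is trivial. -/
theorem eq_top_of_forall_mulVec_mem {k n : Type*} [Field k] [Fintype n] [DecidableEq n]
    {W : Submodule k (n → k)} (hW : W ≠ ⊥)
    (h : ∀ A : Matrix n n k, ∀ w ∈ W, A.mulVec w ∈ W) : W = ⊤ := by
  obtain ⟨w, hw, hw0⟩ := W.ne_bot_iff.1 hW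
  obtain ⟨i, hi⟩ := Function.ne_iff.1 hw0
  refine eq_top_iff.2 fun v _ => ?_
  have := h (Matrix.vecMulVec v (Pi.single i (w i)⁻¹)) w hw
  rw [Matrix.vecMulVec_mulVec] at this
  simpa [inv_mul_cancel₀ hi] using this


/-- For a `k`-subalgebra `𝒜` of `M₂(k)`, the following are equivalent: `Δ(A,B) = 0` for all
`A, B ∈ 𝒜`; `𝒜` is proper; `𝒜` is commutative or has a one-dimensional invariant
subspace. -/
theorem stmt_16 {k : Type*} [Field k] (𝒜 : Subalgebra k (Matrix (Fin 2) (Fin 2) k)) :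
    [∀ A ∈ 𝒜, ∀ B ∈ 𝒜, matrixDisc A B = 0,
      𝒜 ≠ ⊤,
      (∀ X ∈ 𝒜, ∀ Y ∈ 𝒜, X * Y = Y * X) ∨
        ∃ W : Submodule k (Fin 2 → k), Module.finrank k W = 1 ∧
          ∀ A ∈ 𝒜, ∀ w ∈ W, A.mulVec w ∈ W].TFAE := by
  have noncomm : !![0, 1; 0, 0] * !![0, 0; 1, 0] ≠ !![0, 0; 1, 0] * (!![0, 1; 0, 0] :
      Matrix (Fin 2) (Fin 2) k) := fun h => by
    simpa using congrFun (congrFun h 0) 0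
  tfae_have 1 → 3 := fun h => by
    by_contra! hcon
    obtain ⟨⟨X, hX, Y, hY, hXY⟩, hline⟩ := hcon
    obtain ⟨W, hW, hinv⟩ := exists_invariant_line_of_matrixDisc_eq_zero h hX hY hXY
    obtain ⟨A, hA, w, hw, hAw⟩ := hline W hW
    exact hAw (hinv A hA w hw)
  tfae_have 3 → 2 := by
    rintro (hcomm | ⟨W, hW, hinv⟩) rfl
    · exact noncomm (hcomm _ Algebra.mem_top _ Algebra.mem_top)
    · have htop := eq_top_of_forall_mulVec_mem (W := W) (by rintro rfl; simp at hW)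
        fun A => hinv A Algebra.mem_top
      rw [htop, finrank_top, Module.finrank_fin_fun] at hW
      omega
  tfae_have 2 → 1 := fun h A hA B hB => by
    by_contra hne
    exact h (eq_top_of_matrixDisc_ne_zero hA hB hne)
  tfae_finish
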